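/- arXiv:2005.11859 — 5 statements merged into one kernel-verified Lean document; each statement's English description precedes it below -/
import Mathlib

section
/- Let N, P be n×n complex matrices (n ≥ 1), let μ > 0, and set M = N + μP. Assume there is a constant c_op ≥ 1 such that for every w ∈ C not in Σ(N) one has ‖(N − wI)⁻¹‖_op ≤ c_op · ρ((N − wI)⁻¹), and for every w ∈ C not in Σ(M) one has ‖(M − wI)⁻¹‖_op ≤ c_op · ρ((M − wI)⁻¹). Let z ∈ C with z ∉ Σ(N) satisfy dist(z, Σ(N)) ≥ 4 μ c_op ‖P‖_op. Then z ∉ Σ(M) and (1/c_op) · dist(z, Σ(N)) − μ‖P‖_op ≤ dist(z, Σ(M)) ≤ c_op · dist(z, Σ(N)) + μ c_op ‖P‖_op. -/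
/-- Spectral radius (as a real number) of an operator on `ℂ^n`:
the supremum of the moduli of its eigenvalues. -/
noncomputable def specRadius {n : ℕ}
    (A : EuclideanSpace ℂ (Fin n) →L[ℂ] EuclideanSpace ℂ (Fin n)) : ℝ :=
  sSup ((fun z : ℂ => ‖z‖) '' spectrum ℂ A)

/-- The resolvent `(A − w·Id)⁻¹` of an operator on `ℂ^n` (zero if not invertible). -/
noncomputable def resolvent' {n : ℕ}
    (A : EuclideanSpace ℂ (Fin n) →L[ℂ] EuclideanSpace ℂ (Fin n)) (w : ℂ) :
    EuclideanSpace ℂ (Fin n) →L[ℂ] EuclideanSpace ℂ (Fin n) :=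
  Ring.inverse (A - w • 1)

/-- Moduli of eigenvalues of the resolvent are bounded by the inverse distance to the spectrum. -/
theorem specRadius_resolvent'_le {n : ℕ}
    (A : EuclideanSpace ℂ (Fin n) →L[ℂ] EuclideanSpace ℂ (Fin n)) {z : ℂ}
    (hz : IsUnit (A - z • 1)) (hd : 0 < Metric.infDist z (spectrum ℂ A)) :
    specRadius (resolvent' A z) ≤ (Metric.infDist z (spectrum ℂ A))⁻¹ := by
  obtain ⟨u, hu⟩ := hz
  have hR : resolvent' A z = ↑u⁻¹ := by rw [resolvent', ← hu, Ring.inverse_unit]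
  refine Real.sSup_le ?_ (inv_nonneg.2 hd.le)
  rintro _ ⟨l, hl, rfl⟩
  rw [hR] at hl
  have hl0 : l ≠ 0 := spectrum.ne_zero_of_mem_of_unit hl
  have hl' : l⁻¹ ∈ spectrum ℂ (u : EuclideanSpace ℂ (Fin n) →L[ℂ] EuclideanSpace ℂ (Fin n)) := by
    simpa using (spectrum.inv_mem_iff (r := Units.mk0 l hl0) (a := u⁻¹)).1 hl
  have hmem : z + l⁻¹ ∈ spectrum ℂ A := by
    rw [spectrum.mem_iff] at hl' ⊢
    convert hl' using 2
    rw [hu, Algebra.algebraMap_eq_smul_one, Algebra.algebraMap_eq_smul_one, add_smul]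
    abel
  have h := Metric.infDist_le_dist_of_mem (x := z) hmem
  rw [dist_self_add_right, norm_inv] at h
  exact (le_inv_comm₀ hd (norm_pos_iff.2 hl0)).1 h

theorem isUnit_sub_smul_one {n : ℕ}
    {A : EuclideanSpace ℂ (Fin n) →L[ℂ] EuclideanSpace ℂ (Fin n)} {z : ℂ}
    (hz : z ∉ spectrum ℂ A) : IsUnit (A - z • 1) := by
  rw [spectrum.notMem_iff, Algebra.algebraMap_eq_smul_one] at hz
  simpa using hz.neg

/-- If the resolvent of `A` at `z` is controlled by its spectral radius, then the distance from
`z` to the spectrum of `A` is controlled by the distance to any spectral value of a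
perturbation `B` of `A`. -/
theorem infDist_spectrum_le_of_mem_spectrum {n : ℕ} (hn : 1 ≤ n)
    (A B : EuclideanSpace ℂ (Fin n) →L[ℂ] EuclideanSpace ℂ (Fin n)) {c : ℝ} (hc : 0 ≤ c)
    {z w : ℂ} (hz : z ∉ spectrum ℂ A)
    (hres : ‖resolvent' A z‖ ≤ c * specRadius (resolvent' A z)) (hw : w ∈ spectrum ℂ B) :
    Metric.infDist z (spectrum ℂ A) ≤ c * (dist z w + ‖B - A‖) := by
  have : Nonempty (Fin n) := ⟨⟨0, hn⟩⟩
  have hd : 0 < Metric.infDist z (spectrum ℂ A) :=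
    ((spectrum.isClosed A).notMem_iff_infDist_pos (spectrum.nonempty A)).1 hz
  have hA := isUnit_sub_smul_one hz
  have hres' := hres.trans (mul_le_mul_of_nonneg_left (specRadius_resolvent'_le A hA hd) hc)
  obtain ⟨u, hu⟩ := hA
  have hR : resolvent' A z = ↑u⁻¹ := by rw [resolvent', ← hu, Ring.inverse_unit]
  rw [hR] at hres'
  have hpos : 0 < ‖(↑u⁻¹ : EuclideanSpace ℂ (Fin n) →L[ℂ] EuclideanSpace ℂ (Fin n))‖ :=
    Units.norm_pos _
  by_contra! hlt
  set t := (z - w) • (1 : EuclideanSpace ℂ (Fin n) →L[ℂ] EuclideanSpace ℂ (Fin n)) + (B - A)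
    with ht
  have htn : ‖t‖ ≤ dist z w + ‖B - A‖ := by
    refine (norm_add_le _ _).trans ?_
    rw [norm_smul, norm_one, mul_one, dist_eq_norm]
  have hsmall : ‖t‖ < ‖(↑u⁻¹ : EuclideanSpace ℂ (Fin n) →L[ℂ] EuclideanSpace ℂ (Fin n))‖⁻¹ := by
    rw [← one_div, lt_div_iff₀ hpos]
    calc _ ≤ (dist z w + ‖B - A‖) * (c * (Metric.infDist z (spectrum ℂ A))⁻¹) := by gcongr
      _ = c * (dist z w + ‖B - A‖) / Metric.infDist z (spectrum ℂ A) := by ring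
      _ < 1 := (div_lt_one hd).2 hlt
  have hB : B - w • 1 = (u.add t hsmall : EuclideanSpace ℂ (Fin n) →L[ℂ] _) := by
    rw [Units.val_add, hu, ht]
    module
  have hBu : IsUnit (B - w • 1) := hB ▸ Units.isUnit _
  refine spectrum.mem_iff.1 hw ?_
  rw [Algebra.algebraMap_eq_smul_one]
  simpa using hBu.neg

/-- **Localization of the spectrum of `M = N + μP` with respect to the spectrum of `N`.**
Let `N, P` be operators on `ℂ^n`, `μ > 0`, `M = N + μP`.  Assume there is `c_op ≥ 1`
such that for every `w` outside the spectrum of `N` (resp. of `M`) the operator norm of the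
resolvent of `N` (resp. `M`) at `w` is at most `c_op` times its spectral radius.
If `z ∉ Σ(N)` satisfies `dist(z, Σ(N)) ≥ 4 μ c_op ‖P‖`, then `z ∉ Σ(M)` and
`(1/c_op)·dist(z, Σ(N)) − μ‖P‖ ≤ dist(z, Σ(M)) ≤ c_op·dist(z, Σ(N)) + μ c_op ‖P‖`. -/
theorem resolvent_spectrum_localization
    {n : ℕ} (hn : 1 ≤ n)
    (N P : EuclideanSpace ℂ (Fin n) →L[ℂ] EuclideanSpace ℂ (Fin n))
    (μ : ℝ) (hμ : 0 < μ)
    (M : EuclideanSpace ℂ (Fin n) →L[ℂ] EuclideanSpace ℂ (Fin n))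
    (hM : M = N + (μ : ℂ) • P)
    (cop : ℝ) (hcop : 1 ≤ cop)
    (hN_res : ∀ w : ℂ, w ∉ spectrum ℂ N →
      ‖resolvent' N w‖ ≤ cop * specRadius (resolvent' N w))
    (hM_res : ∀ w : ℂ, w ∉ spectrum ℂ M →
      ‖resolvent' M w‖ ≤ cop * specRadius (resolvent' M w))
    (z : ℂ) (hz : z ∉ spectrum ℂ N)
    (hz_far : 4 * μ * cop * ‖P‖ ≤ Metric.infDist z (spectrum ℂ N)) :
    z ∉ spectrum ℂ M ∧
    (1 / cop) * Metric.infDist z (spectrum ℂ N) - μ * ‖P‖ ≤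
        Metric.infDist z (spectrum ℂ M) ∧
    Metric.infDist z (spectrum ℂ M) ≤
        cop * Metric.infDist z (spectrum ℂ N) + μ * cop * ‖P‖ := by
  have : Nonempty (Fin n) := ⟨⟨0, hn⟩⟩
  have hc : 0 < cop := one_pos.trans_le hcop
  have hd : 0 < Metric.infDist z (spectrum ℂ N) :=
    ((spectrum.isClosed N).notMem_iff_infDist_pos (spectrum.nonempty N)).1 hz
  have hMN : ‖M - N‖ = μ * ‖P‖ := by
    rw [hM, add_sub_cancel_left, norm_smul, Complex.norm_real, Real.norm_of_nonneg hμ.le]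
  have hlow : ∀ w ∈ spectrum ℂ M,
      Metric.infDist z (spectrum ℂ N) ≤ cop * (dist z w + μ * ‖P‖) := fun w hw ↦
    hMN ▸ infDist_spectrum_le_of_mem_spectrum hn N M hc.le hz (hN_res z hz) hw
  have hzM : z ∉ spectrum ℂ M := by
    intro h
    have := hlow z h
    rw [dist_self] at this
    linarith
  refine ⟨hzM, ?_, ?_⟩
  · obtain ⟨w, hw, hwd⟩ :=
      (spectrum.isCompact (𝕜 := ℂ) M).exists_infDist_eq_dist (spectrum.nonempty M) z
    rw [hwd, sub_le_iff_le_add, one_div_mul_eq_div, div_le_iff₀' hc]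
    exact hlow w hw
  · obtain ⟨w, hw, hwd⟩ :=
      (spectrum.isCompact (𝕜 := ℂ) N).exists_infDist_eq_dist (spectrum.nonempty N) z
    have := infDist_spectrum_le_of_mem_spectrum hn M N hc.le hzM (hM_res z hzM) hw
    rw [norm_sub_rev, hMN] at this
    rw [hwd]
    linarith
end

section
/- Let N(ε), P(ε) be n×n complex matrices and μ(ε) a scalar, defined for ε in a neighborhood of 0 in R, and set M(ε) = N(ε) + μ(ε)P(ε). Assume: (1) there is c_P > 0 with ‖P(ε)‖_op ≤ c_P for |ε| small, and there is β₁ > 0 with |μ(ε)| ≤ |ε|^{β₁}; (2) there are c_N > 0 and 0 < β₂ < β₁ such that any two distinct eigenvalues λ_i ≠ λ_j of N(ε) satisfy |λ_i − λ_j| ≥ c_N|ε|^{β₂}; (3) there is c_op ≥ 1 such that for every w ∉ Σ(N(ε)), ‖(N(ε) − wI)⁻¹‖_op ≤ c_op · ρ((N(ε) − wI)⁻¹), and for every w ∉ Σ(M(ε)), ‖(M(ε) − wI)⁻¹‖_op ≤ c_op · ρ((M(ε) − wI)⁻¹). Then there exist ε* > 0 and c_M > 0, independent of the eigenvalue chosen,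 such that for every ε with 0 < |ε| < ε* and every eigenvalue λ of N(ε) there exists an eigenvalue ν of M(ε) with |ν − λ| < c_M|ε|^{β₁}. -/
theorem isUnit_sub_smul_one_iff {A : Type*} [Ring A] [Algebra ℂ A] {a : A} {lam : ℂ} :
    IsUnit (a - lam • 1) ↔ lam ∉ spectrum ℂ a := by
  rw [spectrum.notMem_iff, ← IsUnit.neg_iff, neg_sub, Algebra.algebraMap_eq_smul_one]

/-- If `lam` lies in the spectrum of `a` but not of `b`, then the resolvent of `b` at `lam` has norm
at least `‖a - b‖⁻¹`. -/
theorem one_le_norm_inverse_mul_norm_sub {A : Type*} [NormedRing A] [NormedAlgebra ℂ A]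
    [CompleteSpace A] {a b : A} {lam : ℂ} (ha : lam ∈ spectrum ℂ a) (hb : lam ∉ spectrum ℂ b) :
    1 ≤ ‖Ring.inverse (b - lam • 1)‖ * ‖a - b‖ := by
  have : Nontrivial A := by
    by_contra! hA
    simp [spectrum.of_subsingleton] at ha
  by_contra! h
  obtain ⟨u, hu⟩ := isUnit_sub_smul_one_iff.2 hb
  rw [← hu, Ring.inverse_unit] at h
  refine isUnit_sub_smul_one_iff.1 (u.ofNearby (a - lam • 1) ?_).isUnit ha
  rw [hu, sub_sub_sub_cancel_right]
  exact (lt_inv_mul_iff₀ (Units.norm_pos u⁻¹)).2 h |>.trans_eq (mul_one _)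

/-- A point `z` of the spectrum of the resolvent of `b` at `lam` yields the point
`lam + z⁻¹` of the spectrum of `b` (`z` is automatically nonzero). -/
theorem add_inv_mem_spectrum_of_mem_spectrum_inverse {A : Type*} [Ring A] [Algebra ℂ A] {b : A}
    {lam z : ℂ} (hb : lam ∉ spectrum ℂ b) (hz : z ∈ spectrum ℂ (Ring.inverse (b - lam • 1))) :
    lam + z⁻¹ ∈ spectrum ℂ b := by
  obtain ⟨u, hu⟩ := isUnit_sub_smul_one_iff.2 hb
  rw [← hu, Ring.inverse_unit, ← spectrum.inv₀_mem_iff, hu] at hz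
  rw [add_comm, spectrum.add_mem_iff, Algebra.algebraMap_eq_smul_one, neg_add_eq_sub]
  exact hz

/-- **Deformation of eigenvalues under perturbation.**
Let `M(ε) = N(ε) + μ(ε)P(ε)` with `‖P(ε)‖ ≤ c_P` and `|μ(ε)| ≤ |ε|^{β₁}`; assume the
distinct eigenvalues of `N(ε)` are separated by at least `c_N|ε|^{β₂}` with `β₂ < β₁`, and
that the resolvents of `N(ε)` and `M(ε)` satisfy a uniform bound by `c_op` times their
spectral radius.  Then there are `ε* > 0` and `c_M > 0` such that for `0 < |ε| < ε*` and
every eigenvalue `λ` of `N(ε)` there is an eigenvalue `ν` of `M(ε)` with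
`|ν − λ| < c_M|ε|^{β₁}`. -/
theorem eigenvalue_deformation
    {n : ℕ} (hn : 1 ≤ n)
    (ε₀ : ℝ) (hε₀ : 0 < ε₀)
    (N P : ℝ → (EuclideanSpace ℂ (Fin n) →L[ℂ] EuclideanSpace ℂ (Fin n)))
    (μ : ℝ → ℂ)
    (M : ℝ → (EuclideanSpace ℂ (Fin n) →L[ℂ] EuclideanSpace ℂ (Fin n)))
    (hM : ∀ ε : ℝ, M ε = N ε + μ ε • P ε)
    (cP β₁ : ℝ) (hcP : 0 < cP) (hβ₁ : 0 < β₁)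
    (hP : ∀ ε : ℝ, |ε| < ε₀ → ‖P ε‖ ≤ cP)
    (hμ : ∀ ε : ℝ, |ε| < ε₀ → ‖μ ε‖ ≤ |ε| ^ β₁)
    (cN β₂ : ℝ) (hcN : 0 < cN) (hβ₂0 : 0 < β₂) (hβ₂ : β₂ < β₁)
    (hsep : ∀ ε : ℝ, |ε| < ε₀ →
      ∀ lam₁ ∈ spectrum ℂ (N ε), ∀ lam₂ ∈ spectrum ℂ (N ε),
        lam₁ ≠ lam₂ → cN * |ε| ^ β₂ ≤ ‖lam₁ - lam₂‖)
    (cop : ℝ) (hcop : 1 ≤ cop)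
    (hN_res : ∀ ε : ℝ, |ε| < ε₀ → ∀ w : ℂ, w ∉ spectrum ℂ (N ε) →
      ‖resolvent' (N ε) w‖ ≤ cop * specRadius (resolvent' (N ε) w))
    (hM_res : ∀ ε : ℝ, |ε| < ε₀ → ∀ w : ℂ, w ∉ spectrum ℂ (M ε) →
      ‖resolvent' (M ε) w‖ ≤ cop * specRadius (resolvent' (M ε) w)) :
    ∃ εstar > 0, ∃ cM > 0, ∀ ε : ℝ, 0 < |ε| → |ε| < εstar →
      ∀ lam ∈ spectrum ℂ (N ε), ∃ ν ∈ spectrum ℂ (M ε),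
        ‖ν - lam‖ < cM * |ε| ^ β₁ := by
  refine ⟨ε₀, hε₀, cop * cP + 1, by positivity, fun ε hpos hε lam hlam => ?_⟩
  have hpow : 0 < |ε| ^ β₁ := Real.rpow_pos_of_pos hpos β₁
  by_cases hb : lam ∈ spectrum ℂ (M ε)
  · exact ⟨lam, hb, by rw [sub_self, norm_zero]; positivity⟩
  have hone := one_le_norm_inverse_mul_norm_sub hlam hb
  have hdiff : ‖N ε - M ε‖ ≤ |ε| ^ β₁ * cP := by
    rw [hM, sub_add_cancel_left, norm_neg, norm_smul]
    exact mul_le_mul (hμ ε hε) (hP ε hε) (norm_nonneg _) hpow.le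
  have hres := hM_res ε hε lam hb
  have hlow : 1 ≤ cop * specRadius (resolvent' (M ε) lam) * (|ε| ^ β₁ * cP) :=
    hone.trans (mul_le_mul hres hdiff (norm_nonneg _) ((norm_nonneg _).trans hres))
  have hne : (spectrum ℂ (resolvent' (M ε) lam)).Nonempty := by
    by_contra! h
    rw [specRadius, h, Set.image_empty, Real.sSup_empty] at hlow
    norm_num at hlow
  obtain ⟨z, hz, hzmax⟩ := (spectrum.isCompact (𝕜 := ℂ) (resolvent' (M ε) lam)).exists_sSup_image_eq
    hne continuous_norm.continuousOn
  rw [specRadius, hzmax] at hlow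
  have hz0 : z ≠ 0 := by
    rintro rfl
    norm_num at hlow
  refine ⟨lam + z⁻¹, add_inv_mem_spectrum_of_mem_spectrum_inverse hb hz, ?_⟩
  have hzpos : 0 < ‖z‖ := norm_pos_iff.2 hz0
  rw [add_sub_cancel_left, norm_inv]
  calc ‖z‖⁻¹ ≤ cop * cP * |ε| ^ β₁ := by
        rw [inv_le_iff_one_le_mul₀ hzpos]
        linarith
    _ < (cop * cP + 1) * |ε| ^ β₁ := by linarith
end

section
/- Define sequences of positive integers as follows: ν_{0,s} = 1 for all s ≥ 0, and for r ≥ 1 and s ≥ 0: ν^{(I)}_{r,s} = Σ_{j=0}^{⌊s/r⌋} (ν_{r−1,r})^j · ν_{r−1, s−jr}; ν^{(II)}_{r,s} = Σ_{j=0}^{⌊s/r⌋} (ν^{(I)}_{r,r})^j · ν^{(I)}_{r, s−jr}; ν^{(III)}_{r,s} = Σ_{j=0}^{⌊s/r⌋} (2 ν^{(II)}_{r,r})^j · ν^{(II)}_{r, s−jr}; ν^{(IV)}_{r,s} = Σ_{j=0}^{⌊s/r⌋} (ν^{(III)}_{r,r})^j · ν^{(III)}_{r, s−jr}; and ν_{r,s}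 = Σ_{j=0}^{⌊s/r⌋} (ν^{(IV)}_{r,r})^j · ν^{(IV)}_{r, s−jr}. Then for all r ≥ 0 and all s ≥ 1 one has ν_{r,s} ≤ ν_{s,s} ≤ 2^{14s}/2^8. -/
/-- One stage of the counting recursion:
`nextStage r c f s = Σ_{j=0}^{⌊s/r⌋} c^j · f (s − j·r)`. -/
def nextStage (r c : ℕ) (f : ℕ → ℕ) (s : ℕ) : ℕ :=
  ∑ j ∈ Finset.range (s / r + 1), c ^ j * f (s - j * r)

/-- The sequence `ν_{r,s}` counting the number of terms generated by the five stages of the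
`r`-th step of the normal form algorithm: `ν_{0,s} = 1`, and for `r ≥ 1` the row `ν_{r,·}`
is obtained from `ν_{r−1,·}` by the five successive stage recursions
(with multipliers `ν_{r−1,r}`, `ν^{(I)}_{r,r}`, `2ν^{(II)}_{r,r}`, `ν^{(III)}_{r,r}`,
`ν^{(IV)}_{r,r}`). -/
def nu : ℕ → ℕ → ℕ
  | 0 => fun _ => 1
  | (r + 1) =>
    let f0 := nu r
    let fI := nextStage (r + 1) (f0 (r + 1)) f0
    let fII := nextStage (r + 1) (fI (r + 1)) fI
    let fIII := nextStage (r + 1) (2 * fII (r + 1)) fII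
    let fIV := nextStage (r + 1) (fIII (r + 1)) fIII
    nextStage (r + 1) (fIV (r + 1)) fIV

theorem nextStage_of_lt {r s : ℕ} (c : ℕ) (f : ℕ → ℕ) (h : s < r) :
    nextStage r c f s = f s := by
  simp [nextStage, Nat.div_eq_of_lt h]

theorem nextStage_of_le {r s : ℕ} (c : ℕ) (f : ℕ → ℕ) (hr : 0 < r) (h : r ≤ s) :
    nextStage r c f s = f s + c * nextStage r c f (s - r) := by
  have hdiv : s / r = (s - r) / r + 1 := Nat.div_eq_sub_div hr h
  unfold nextStage
  rw [hdiv, Finset.sum_range_succ', Finset.mul_sum, add_comm]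
  congr 1
  · simp
  · refine Finset.sum_congr rfl fun j _ => ?_
    rw [pow_succ', mul_assoc, Nat.sub_sub, add_one_mul, add_comm r]

theorem nextStage_zero {r : ℕ} (c : ℕ) (f : ℕ → ℕ) : nextStage r c f 0 = f 0 := by
  simp [nextStage]

theorem nextStage_self {r : ℕ} (c : ℕ) (f : ℕ → ℕ) (hr : 0 < r) :
    nextStage r c f r = f r + c * f 0 := by
  rw [nextStage_of_le c f hr le_rfl, Nat.sub_self, nextStage_zero]

theorem le_nextStage (r c : ℕ) (f : ℕ → ℕ) (s : ℕ) : f s ≤ nextStage r c f s := by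
  simpa [nextStage] using Finset.single_le_sum
    (f := fun j => c ^ j * f (s - j * r)) (fun _ _ => Nat.zero_le _)
    (Finset.mem_range.2 (Nat.succ_pos (s / r)))

theorem nu_zero_right (r : ℕ) : nu r 0 = 1 := by
  induction r with
  | zero => rfl
  | succ r ih => simp only [nu, nextStage_zero, ih]

/-- The five multipliers of a step are `1, 2, 8, 12, 24` times the first one. -/
theorem nu_succ (r s : ℕ) :
    nu (r + 1) s =
      nextStage (r + 1) (24 * nu r (r + 1)) (nextStage (r + 1) (12 * nu r (r + 1))
        (nextStage (r + 1) (8 * nu r (r + 1)) (nextStage (r + 1) (2 * nu r (r + 1))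
          (nextStage (r + 1) (nu r (r + 1)) (nu r))))) s := by
  simp only [nu, nextStage_self _ _ (Nat.add_one_pos r), nextStage_zero, nu_zero_right]
  ring_nf

theorem nu_succ_self (r : ℕ) : nu (r + 1) (r + 1) = 48 * nu r (r + 1) := by
  simp only [nu_succ, nextStage_self _ _ (Nat.add_one_pos r), nextStage_zero, nu_zero_right]
  ring

theorem nu_mono_left (s : ℕ) : Monotone fun r => nu r s := by
  refine monotone_nat_of_le_succ fun r => ?_
  simp only [nu]
  iterate 4 refine le_trans ?_ (le_nextStage _ _ _ _)
  exact le_nextStage _ _ _ _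

theorem nu_eq_self_of_le {r s : ℕ} (h : s ≤ r) : nu r s = nu s s := by
  induction r, h using Nat.le_induction with
  | base => rfl
  | succ r h ih =>
    simp only [nu_succ, nextStage_of_lt _ _ (Nat.lt_succ_of_le h), ih]

theorem nu_le_self (r s : ℕ) : nu r s ≤ nu s s := by
  rcases le_total s r with h | h
  · exact (nu_eq_self_of_le h).le
  · exact nu_mono_left s h

theorem nu_succ_le {r s : ℕ} (h : r + 1 ≤ s) :
    nu (r + 1) s ≤ nu r s + 47 * nu r (r + 1) * nu (r + 1) (s - (r + 1)) := by
  have hr := Nat.succ_pos r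
  rw [nu_succ, nu_succ r (s - (r + 1))]
  generalize nu r (r + 1) = a
  set f1 := nextStage (r + 1) a (nu r) with h1
  set f2 := nextStage (r + 1) (2 * a) f1 with h2
  set f3 := nextStage (r + 1) (8 * a) f2 with h3
  set f4 := nextStage (r + 1) (12 * a) f3 with h4
  set f5 := nextStage (r + 1) (24 * a) f4 with h5
  have e1 : f1 s = _ := nextStage_of_le a (nu r) hr h
  have e2 : f2 s = _ := nextStage_of_le (2 * a) f1 hr h
  have e3 : f3 s = _ := nextStage_of_le (8 * a) f2 hr h
  have e4 : f4 s = _ := nextStage_of_le (12 * a) f3 hr h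
  have e5 : f5 s = _ := nextStage_of_le (24 * a) f4 hr h
  rw [← h1] at e1
  rw [← h2] at e2
  rw [← h3] at e3
  rw [← h4] at e4
  rw [← h5] at e5
  set t := s - (r + 1)
  have l4 : f4 t ≤ f5 t := le_nextStage _ _ _ _
  have l3 : f3 t ≤ f5 t := (le_nextStage _ _ _ _).trans l4
  have l2 : f2 t ≤ f5 t := (le_nextStage _ _ _ _).trans l3
  have l1 : f1 t ≤ f5 t := (le_nextStage _ _ _ _).trans l2
  rw [e5, e4, e3, e2, e1]
  nlinarith [Nat.mul_le_mul_left a l1, Nat.mul_le_mul_left a l2, Nat.mul_le_mul_left a l3,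
    Nat.mul_le_mul_left a l4]

theorem nu_le_sum {r s : ℕ} (h : r ≤ s) :
    48 * nu r s ≤
      48 + 47 * ∑ j ∈ Finset.range r, nu (j + 1) (j + 1) * nu (s - (j + 1)) (s - (j + 1)) := by
  induction r with
  | zero => simp [nu]
  | succ r ih =>
    rw [Finset.sum_range_succ]
    have h1 := nu_succ_le h
    have h2 := Nat.mul_le_mul_left (nu (r + 1) (r + 1)) (nu_le_self (r + 1) (s - (r + 1)))
    rw [nu_succ_self r] at h2 ⊢
    have h3 := ih (by omega)
    linarith

theorem nu_one_one : nu 1 1 = 48 := by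
  rw [nu_succ_self 0]
  rfl

theorem nu_self_le_sum (n : ℕ) :
    nu (n + 2) (n + 2) ≤
      48 * ∑ j ∈ Finset.range (n + 1), nu (j + 1) (j + 1) * nu (n - j + 1) (n - j + 1) := by
  have h : 48 * nu (n + 1) (n + 2) ≤ _ := nu_le_sum (Nat.le_succ (n + 1))
  rw [← nu_succ_self (n + 1)] at h
  have hsum : ∑ j ∈ Finset.range (n + 1),
        nu (j + 1) (j + 1) * nu (n + 2 - (j + 1)) (n + 2 - (j + 1)) =
      ∑ j ∈ Finset.range (n + 1), nu (j + 1) (j + 1) * nu (n - j + 1) (n - j + 1) := by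
    refine Finset.sum_congr rfl fun j hj => ?_
    rw [show n + 2 - (j + 1) = n - j + 1 by have := Finset.mem_range.1 hj; omega]
  rw [hsum] at h
  have hpos : 48 ≤ ∑ j ∈ Finset.range (n + 1),
      nu (j + 1) (j + 1) * nu (n - j + 1) (n - j + 1) := by
    have h0 := Finset.single_le_sum
      (f := fun j => nu (j + 1) (j + 1) * nu (n - j + 1) (n - j + 1))
      (fun _ _ => Nat.zero_le _) (Finset.mem_range.2 (Nat.add_one_pos n))
    have h1 : 1 ≤ nu (n + 1) (n + 1) := by
      simpa [nu] using nu_mono_left (n + 1) (Nat.zero_le (n + 1))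
    simp only [zero_add, nu_one_one, Nat.sub_zero] at h0
    omega
  change nu (n + 1 + 1) (n + 1 + 1) ≤ _
  omega

theorem nu_self_le_catalan (n : ℕ) :
    nu (n + 1) (n + 1) ≤ 48 * 2304 ^ n * catalan n := by
  induction n using Nat.strong_induction_on with
  | _ n ih =>
    rcases n with _ | n
    · simp [nu_one_one]
    · refine (nu_self_le_sum n).trans ?_
      rw [catalan_succ, Fin.sum_univ_eq_sum_range (fun i => catalan i * catalan (n - i)) n.succ,
        Finset.mul_sum, Finset.mul_sum]
      refine Finset.sum_le_sum fun j hj => ?_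
      have hj := Finset.mem_range.1 hj
      have hpow : 2304 ^ j * 2304 ^ (n - j) = 2304 ^ n := by
        rw [← pow_add]; congr 1; omega
      calc 48 * (nu (j + 1) (j + 1) * nu (n - j + 1) (n - j + 1))
          ≤ 48 * ((48 * 2304 ^ j * catalan j) * (48 * 2304 ^ (n - j) * catalan (n - j))) := by
            gcongr
            · exact ih j (by omega)
            · exact ih (n - j) (by omega)
        _ = 48 * 2304 * (2304 ^ j * 2304 ^ (n - j)) * (catalan j * catalan (n - j)) := by ring
        _ = 48 * 2304 ^ (n + 1) * (catalan j * catalan (n - j)) := by rw [hpow]; ring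

theorem catalan_le_four_pow (n : ℕ) : catalan n ≤ 4 ^ n := by
  rw [catalan_eq_centralBinom_div]
  exact (Nat.div_le_self _ _).trans (Nat.centralBinom_le_four_pow n)

theorem nu_self_mul_le (n : ℕ) : nu (n + 1) (n + 1) * 2 ^ 8 ≤ 2 ^ (14 * (n + 1)) :=
  calc nu (n + 1) (n + 1) * 2 ^ 8 ≤ 48 * 2304 ^ n * 4 ^ n * 2 ^ 8 := by
        gcongr
        exact (nu_self_le_catalan n).trans (by gcongr; exact catalan_le_four_pow n)
    _ = 12288 * (2304 * 4) ^ n := by rw [mul_pow]; ring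
    _ ≤ 2 ^ 14 * (2 ^ 14) ^ n := by gcongr <;> norm_num
    _ = 2 ^ (14 * (n + 1)) := by rw [pow_mul, pow_succ' (2 ^ 14)]

/-- **Bound on the counting sequences.**  For all `r ≥ 0` and `s ≥ 1` one has
`ν_{r,s} ≤ ν_{s,s} ≤ 2^{14s}/2^8`. -/
theorem nu_le_bound (r s : ℕ) (hs : 1 ≤ s) :
    nu r s ≤ nu s s ∧ (nu s s : ℝ) ≤ 2 ^ (14 * s) / 2 ^ 8 := by
  refine ⟨nu_le_self r s, ?_⟩
  obtain ⟨n, rfl⟩ := Nat.exists_eq_add_of_le' hs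
  rw [le_div_iff₀ (by positivity)]
  exact_mod_cast nu_self_mul_le n
end

section
/- Let n₁, n₂ be positive integers, ω ∈ R, Ω ∈ R^{n₂}, σ > 0, and suppose there is α > 0 such that |k₁ ω + Ω_j| ≥ α and |k₁ ω − Ω_j| ≥ α for all k₁ ∈ Z and all j ∈ {1,…,n₂} (first Melnikov condition). Let a_{j,k}, b_{j,k} ∈ C (j = 1,…,n₂, k ∈ Z^{n₁}) satisfy N := Σ_{j,k} (|a_{j,k}| + |b_{j,k}|) e^{|k|σ} < ∞, and define f(q̂, ξ, η) = Σ_{j,k} e^{i⟨k,q̂⟩}(a_{j,k} ξ_j + b_{j,k} η_j). Define χ(q̂, ξ, η) = Σ_{j,k} e^{i⟨k,q̂⟩}( (a_{j,k}/(i(k₁ω + Ω_j))) ξ_j + (b_{j,k}/(i(k₁ω − Ω_j))) η_j ). Then the series defining χ converges absolutely, χ satisfies ω · ∂χ/∂q₁ + Σ_{j=1}^{n₂} i Ω_j (ξ_j · ∂χ/∂ξ_j − η_j · ∂χ/∂η_j) = f identically, and Σ_{j,k} ( |a_{j,k}|/|k₁ω + Ω_j| + |b_{j,k}|/|k₁ω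 − Ω_j| ) e^{|k|σ} ≤ N/α. -/
/-- A term of the part of the perturbation which is linear in the transverse Cartesian
variables: `e^{i⟨k,q̂⟩}(a_{j,k} ξ_j + b_{j,k} η_j)`. -/
noncomputable def transvTerm (n₁ n₂ : ℕ) (a b : Fin n₂ → (Fin n₁ → ℤ) → ℂ)
    (p : Fin n₂ × (Fin n₁ → ℤ))
    (x : (Fin n₁ → ℝ) × (Fin n₂ → ℂ) × (Fin n₂ → ℂ)) : ℂ :=
  Complex.exp (Complex.I * ∑ j, (p.2 j : ℂ) * (x.1 j : ℂ)) *
    (a p.1 p.2 * x.2.1 p.1 + b p.1 p.2 * x.2.2 p.1)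

/-- A term of the generating function solving the homological equation for the part linear
in the transverse variables:
`e^{i⟨k,q̂⟩}( (a_{j,k}/(i(k₁ω + Ω_j))) ξ_j + (b_{j,k}/(i(k₁ω − Ω_j))) η_j )`. -/
noncomputable def genTerm (n₁ n₂ : ℕ) (i₀ : Fin n₁) (ω : ℝ) (Ω : Fin n₂ → ℝ)
    (a b : Fin n₂ → (Fin n₁ → ℤ) → ℂ) (p : Fin n₂ × (Fin n₁ → ℤ))
    (x : (Fin n₁ → ℝ) × (Fin n₂ → ℂ) × (Fin n₂ → ℂ)) : ℂ :=
  Complex.exp (Complex.I * ∑ j, (p.2 j : ℂ) * (x.1 j : ℂ)) *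
    (a p.1 p.2 / (Complex.I * ((p.2 i₀ : ℂ) * (ω : ℂ) + (Ω p.1 : ℂ))) * x.2.1 p.1 +
     b p.1 p.2 / (Complex.I * ((p.2 i₀ : ℂ) * (ω : ℂ) - (Ω p.1 : ℂ))) * x.2.2 p.1)

open ContinuousLinearMap in
/-- The real-linear form `(q, ξ, η) ↦ ⟨k, q⟩`, with complex values. -/
noncomputable def phaseCLM (n₁ n₂ : ℕ) (k : Fin n₁ → ℤ) :
    ((Fin n₁ → ℝ) × (Fin n₂ → ℂ) × (Fin n₂ → ℂ)) →L[ℝ] ℂ :=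
  ∑ j, (k j : ℂ) • (Complex.ofRealCLM ∘L proj j ∘L fst ℝ _ _)

open ContinuousLinearMap in
/-- The real-linear form `(q, ξ, η) ↦ A ξ_j + B η_j`. -/
noncomputable def transvCLM (n₁ n₂ : ℕ) (A B : ℂ) (j : Fin n₂) :
    ((Fin n₁ → ℝ) × (Fin n₂ → ℂ) × (Fin n₂ → ℂ)) →L[ℝ] ℂ :=
  A • (proj j ∘L fst ℝ _ _ ∘L snd ℝ _ _) + B • (proj j ∘L snd ℝ _ _ ∘L snd ℝ _ _)

/-- The differential of `transvTerm`. -/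
noncomputable def transvDeriv (n₁ n₂ : ℕ) (a b : Fin n₂ → (Fin n₁ → ℤ) → ℂ)
    (p : Fin n₂ × (Fin n₁ → ℤ)) (x : (Fin n₁ → ℝ) × (Fin n₂ → ℂ) × (Fin n₂ → ℂ)) :
    ((Fin n₁ → ℝ) × (Fin n₂ → ℂ) × (Fin n₂ → ℂ)) →L[ℝ] ℂ :=
  Complex.exp (Complex.I * phaseCLM n₁ n₂ p.2 x) • transvCLM n₁ n₂ (a p.1 p.2) (b p.1 p.2) p.1 +
    transvCLM n₁ n₂ (a p.1 p.2) (b p.1 p.2) p.1 x •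
      Complex.exp (Complex.I * phaseCLM n₁ n₂ p.2 x) • Complex.I • phaseCLM n₁ n₂ p.2

section

variable {n₁ n₂ : ℕ}

theorem phaseCLM_apply (k : Fin n₁ → ℤ) (x : (Fin n₁ → ℝ) × (Fin n₂ → ℂ) × (Fin n₂ → ℂ)) :
    phaseCLM n₁ n₂ k x = ∑ j, (k j : ℂ) * (x.1 j : ℂ) := by
  simp [phaseCLM]

theorem transvCLM_apply (A B : ℂ) (j : Fin n₂)
    (x : (Fin n₁ → ℝ) × (Fin n₂ → ℂ) × (Fin n₂ → ℂ)) :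
    transvCLM n₁ n₂ A B j x = A * x.2.1 j + B * x.2.2 j := by
  simp [transvCLM]

theorem norm_phaseCLM_apply_le (k : Fin n₁ → ℤ)
    (x : (Fin n₁ → ℝ) × (Fin n₂ → ℂ) × (Fin n₂ → ℂ)) :
    ‖phaseCLM n₁ n₂ k x‖ ≤ ((∑ j, (k j).natAbs : ℕ) : ℝ) * ‖x‖ := by
  rw [phaseCLM_apply, Nat.cast_sum, Finset.sum_mul]
  refine (norm_sum_le _ _).trans (Finset.sum_le_sum fun j _ => ?_)
  rw [norm_mul, Complex.norm_intCast, Complex.norm_real, Nat.cast_natAbs, Int.cast_abs]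
  gcongr
  exact (norm_le_pi_norm x.1 j).trans (norm_fst_le x)

theorem norm_transvCLM_apply_le (A B : ℂ) (j : Fin n₂)
    (x : (Fin n₁ → ℝ) × (Fin n₂ → ℂ) × (Fin n₂ → ℂ)) :
    ‖transvCLM n₁ n₂ A B j x‖ ≤ (‖A‖ + ‖B‖) * ‖x‖ := by
  rw [transvCLM_apply, add_mul]
  refine (norm_add_le _ _).trans ?_
  rw [norm_mul, norm_mul]
  gcongr
  · exact (norm_le_pi_norm x.2.1 j).trans ((norm_fst_le x.2).trans (norm_snd_le x))
  · exact (norm_le_pi_norm x.2.2 j).trans ((norm_snd_le x.2).trans (norm_snd_le x))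

theorem norm_exp_I_mul_phaseCLM (k : Fin n₁ → ℤ)
    (x : (Fin n₁ → ℝ) × (Fin n₂ → ℂ) × (Fin n₂ → ℂ)) :
    ‖Complex.exp (Complex.I * phaseCLM n₁ n₂ k x)‖ = 1 := by
  have h : phaseCLM n₁ n₂ k x = ((∑ j, (k j : ℝ) * x.1 j : ℝ) : ℂ) := by
    rw [phaseCLM_apply]; push_cast; rfl
  rw [h, Complex.norm_exp_I_mul_ofReal]

variable (a b : Fin n₂ → (Fin n₁ → ℤ) → ℂ)

theorem transvTerm_eq (p : Fin n₂ × (Fin n₁ → ℤ))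
    (x : (Fin n₁ → ℝ) × (Fin n₂ → ℂ) × (Fin n₂ → ℂ)) :
    transvTerm n₁ n₂ a b p x = Complex.exp (Complex.I * phaseCLM n₁ n₂ p.2 x) *
      transvCLM n₁ n₂ (a p.1 p.2) (b p.1 p.2) p.1 x := by
  rw [transvTerm, phaseCLM_apply, transvCLM_apply]

theorem hasFDerivAt_transvTerm (p : Fin n₂ × (Fin n₁ → ℤ))
    (x : (Fin n₁ → ℝ) × (Fin n₂ → ℂ) × (Fin n₂ → ℂ)) :
    HasFDerivAt (transvTerm n₁ n₂ a b p) (transvDeriv n₁ n₂ a b p x) x := by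
  rw [funext (transvTerm_eq a b p)]
  exact (((phaseCLM n₁ n₂ p.2).hasFDerivAt.const_mul Complex.I).cexp).mul
    (transvCLM n₁ n₂ (a p.1 p.2) (b p.1 p.2) p.1).hasFDerivAt

theorem norm_transvDeriv_le (p : Fin n₂ × (Fin n₁ → ℤ))
    (x : (Fin n₁ → ℝ) × (Fin n₂ → ℂ) × (Fin n₂ → ℂ)) :
    ‖transvDeriv n₁ n₂ a b p x‖ ≤
      (‖a p.1 p.2‖ + ‖b p.1 p.2‖) * (1 + ‖x‖ * ((∑ j, (p.2 j).natAbs : ℕ) : ℝ)) := by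
  refine ContinuousLinearMap.opNorm_le_bound _ (by positivity) fun v => ?_
  have h₁ := norm_transvCLM_apply_le (a p.1 p.2) (b p.1 p.2) p.1 v
  have h₂ := mul_le_mul (norm_transvCLM_apply_le (a p.1 p.2) (b p.1 p.2) p.1 x)
    (norm_phaseCLM_apply_le p.2 v) (norm_nonneg _) (by positivity)
  simp only [transvDeriv, add_apply, smul_apply, smul_eq_mul]
  refine (norm_add_le _ _).trans ?_
  simp only [norm_mul, norm_exp_I_mul_phaseCLM, Complex.norm_I, one_mul]
  linarith

variable {a b} {σ : ℝ}

theorem summable_norm_transvTerm (hσ : 0 < σ)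
    (hN : Summable (fun p : Fin n₂ × (Fin n₁ → ℤ) =>
      (‖a p.1 p.2‖ + ‖b p.1 p.2‖) * Real.exp (((∑ j, (p.2 j).natAbs : ℕ) : ℝ) * σ)))
    (x : (Fin n₁ → ℝ) × (Fin n₂ → ℂ) × (Fin n₂ → ℂ)) :
    Summable (fun p => ‖transvTerm n₁ n₂ a b p x‖) := by
  refine Summable.of_nonneg_of_le (fun _ => norm_nonneg _) (fun p => ?_) (hN.mul_right ‖x‖)
  rw [transvTerm_eq, norm_mul, norm_exp_I_mul_phaseCLM, one_mul]
  refine (norm_transvCLM_apply_le _ _ _ _).trans ?_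
  gcongr
  exact le_mul_of_one_le_right (by positivity) (Real.one_le_exp (by positivity))

theorem norm_transvDeriv_le_exp (hσ : 0 < σ) {R : ℝ} (p : Fin n₂ × (Fin n₁ → ℤ))
    {x : (Fin n₁ → ℝ) × (Fin n₂ → ℂ) × (Fin n₂ → ℂ)} (hx : ‖x‖ ≤ R) :
    ‖transvDeriv n₁ n₂ a b p x‖ ≤ (‖a p.1 p.2‖ + ‖b p.1 p.2‖) *
      Real.exp (((∑ j, (p.2 j).natAbs : ℕ) : ℝ) * σ) * (1 + R / σ) := by
  refine (norm_transvDeriv_le a b p x).trans ?_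
  rw [mul_assoc]
  gcongr
  set K : ℝ := ((∑ j, (p.2 j).natAbs : ℕ) : ℝ)
  have hK : 0 ≤ K := Nat.cast_nonneg _
  have hR : 0 ≤ R := (norm_nonneg x).trans hx
  calc 1 + ‖x‖ * K ≤ 1 + R * K := by gcongr
    _ = 1 + R / σ * (K * σ) := by field_simp
    _ ≤ Real.exp (K * σ) + R / σ * Real.exp (K * σ) := by
        gcongr
        · exact Real.one_le_exp (by positivity)
        · linarith [Real.add_one_le_exp (K * σ)]
    _ = Real.exp (K * σ) * (1 + R / σ) := by ring

theorem summable_transvDeriv (hσ : 0 < σ)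
    (hN : Summable (fun p : Fin n₂ × (Fin n₁ → ℤ) =>
      (‖a p.1 p.2‖ + ‖b p.1 p.2‖) * Real.exp (((∑ j, (p.2 j).natAbs : ℕ) : ℝ) * σ)))
    (x : (Fin n₁ → ℝ) × (Fin n₂ → ℂ) × (Fin n₂ → ℂ)) :
    Summable (fun p => transvDeriv n₁ n₂ a b p x) :=
  Summable.of_norm_bounded (hN.mul_right (1 + ‖x‖ / σ))
    fun p => norm_transvDeriv_le_exp hσ p le_rfl

theorem hasFDerivAt_tsum_transvTerm (hσ : 0 < σ)
    (hN : Summable (fun p : Fin n₂ × (Fin n₁ → ℤ) =>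
      (‖a p.1 p.2‖ + ‖b p.1 p.2‖) * Real.exp (((∑ j, (p.2 j).natAbs : ℕ) : ℝ) * σ)))
    (x : (Fin n₁ → ℝ) × (Fin n₂ → ℂ) × (Fin n₂ → ℂ)) :
    HasFDerivAt (fun y => ∑' p, transvTerm n₁ n₂ a b p y)
      (∑' p, transvDeriv n₁ n₂ a b p x) x := by
  have hx : x ∈ Metric.ball (0 : (Fin n₁ → ℝ) × (Fin n₂ → ℂ) × (Fin n₂ → ℂ)) (‖x‖ + 1) := by
    simp
  refine hasFDerivAt_tsum_of_isPreconnected (hN.mul_right (1 + (‖x‖ + 1) / σ)) Metric.isOpen_ball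
    (convex_ball _ _).isPreconnected (fun p y _ => hasFDerivAt_transvTerm a b p y)
    (fun p y hy => norm_transvDeriv_le_exp hσ p (mem_ball_zero_iff.1 hy).le) hx
    (summable_norm_transvTerm hσ hN x).of_norm hx

theorem hasSum_fderiv_tsum_transvTerm (hσ : 0 < σ)
    (hN : Summable (fun p : Fin n₂ × (Fin n₁ → ℤ) =>
      (‖a p.1 p.2‖ + ‖b p.1 p.2‖) * Real.exp (((∑ j, (p.2 j).natAbs : ℕ) : ℝ) * σ)))
    (x v : (Fin n₁ → ℝ) × (Fin n₂ → ℂ) × (Fin n₂ → ℂ)) :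
    HasSum (fun p => transvDeriv n₁ n₂ a b p x v)
      (fderiv ℝ (fun y => ∑' p, transvTerm n₁ n₂ a b p y) x v) := by
  rw [(hasFDerivAt_tsum_transvTerm hσ hN x).fderiv]
  exact (summable_transvDeriv hσ hN x).hasSum.mapL (ContinuousLinearMap.apply ℝ ℂ v)

/-- The transport operator `ω ∂/∂q_i + Σ_j iΩ_j(ξ_j ∂/∂ξ_j − η_j ∂/∂η_j)` acts diagonally on the
monomials. -/
theorem transport_transvTerm (i : Fin n₁) (ω : ℝ) (Ω : Fin n₂ → ℝ) (p : Fin n₂ × (Fin n₁ → ℤ))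
    (x : (Fin n₁ → ℝ) × (Fin n₂ → ℂ) × (Fin n₂ → ℂ)) :
    (ω : ℂ) * transvDeriv n₁ n₂ a b p x (Pi.single i 1, 0, 0) +
        ∑ j : Fin n₂, Complex.I * (Ω j : ℂ) *
          (x.2.1 j * transvDeriv n₁ n₂ a b p x (0, Pi.single j 1, 0) -
           x.2.2 j * transvDeriv n₁ n₂ a b p x (0, 0, Pi.single j 1)) =
      transvTerm n₁ n₂ (fun j k => Complex.I * ((k i : ℂ) * ω + Ω j) * a j k)
        (fun j k => Complex.I * ((k i : ℂ) * ω - Ω j) * b j k) p x := by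
  simp only [transvTerm_eq, transvDeriv, add_apply, smul_apply, smul_eq_mul]
  generalize Complex.exp (Complex.I * phaseCLM n₁ n₂ p.2 x) = e
  have h : ∀ j, Complex.I * (Ω j : ℂ) *
      (x.2.1 j * (e * (a p.1 p.2 * (Pi.single j 1 : Fin n₂ → ℂ) p.1)) -
        x.2.2 j * (e * (b p.1 p.2 * (Pi.single j 1 : Fin n₂ → ℂ) p.1))) =
      if p.1 = j then Complex.I * (Ω j : ℂ) * e *
        (a p.1 p.2 * x.2.1 j - b p.1 p.2 * x.2.2 j) else 0 := by
    intro j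
    rw [Pi.single_apply]
    split_ifs <;> ring
  have hk : ∑ j, (p.2 j : ℂ) * (((Pi.single i 1 : Fin n₁ → ℝ) j : ℝ) : ℂ) = p.2 i := by
    simp [Pi.single_apply, apply_ite (Complex.ofReal)]
  simp only [transvCLM_apply, phaseCLM_apply, hk, Pi.zero_apply, Complex.ofReal_zero, mul_zero,
    add_zero, zero_add, Finset.sum_const_zero, h, Finset.sum_ite_eq, Finset.mem_univ, if_true]
  ring

theorem transport_tsum_transvTerm (hσ : 0 < σ)
    (hN : Summable (fun p : Fin n₂ × (Fin n₁ → ℤ) =>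
      (‖a p.1 p.2‖ + ‖b p.1 p.2‖) * Real.exp (((∑ j, (p.2 j).natAbs : ℕ) : ℝ) * σ)))
    (i : Fin n₁) (ω : ℝ) (Ω : Fin n₂ → ℝ) (x : (Fin n₁ → ℝ) × (Fin n₂ → ℂ) × (Fin n₂ → ℂ)) :
    (ω : ℂ) * fderiv ℝ (fun y => ∑' p, transvTerm n₁ n₂ a b p y) x (Pi.single i 1, 0, 0) +
        ∑ j : Fin n₂, Complex.I * (Ω j : ℂ) *
          (x.2.1 j * fderiv ℝ (fun y => ∑' p, transvTerm n₁ n₂ a b p y) x (0, Pi.single j 1, 0) -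
           x.2.2 j * fderiv ℝ (fun y => ∑' p, transvTerm n₁ n₂ a b p y) x (0, 0, Pi.single j 1)) =
      ∑' p, transvTerm n₁ n₂ (fun j k => Complex.I * ((k i : ℂ) * ω + Ω j) * a j k)
        (fun j k => Complex.I * ((k i : ℂ) * ω - Ω j) * b j k) p x := by
  have hD := hasSum_fderiv_tsum_transvTerm hσ hN x
  have h := ((hD (Pi.single i 1, 0, 0)).mul_left (ω : ℂ)).add
    (hasSum_sum (s := Finset.univ) fun j _ =>
      (((hD (0, Pi.single j 1, 0)).mul_left (x.2.1 j)).sub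
        ((hD (0, 0, Pi.single j 1)).mul_left (x.2.2 j))).mul_left (Complex.I * (Ω j : ℂ)))
  simp only [transport_transvTerm] at h
  exact h.tsum_eq.symm

/-- Dividing the coefficients by divisors of size at least `α` costs a factor `1 / α`. -/
theorem div_add_div_mul_le {α A B u v w : ℝ} (hα : 0 < α) (hA : 0 ≤ A) (hB : 0 ≤ B) (hw : 0 ≤ w)
    (hu : α ≤ u) (hv : α ≤ v) : (A / u + B / v) * w ≤ (A + B) * w / α := by
  calc (A / u + B / v) * w ≤ (A / α + B / α) * w := by gcongr
    _ = (A + B) * w / α := by ring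

end

/-- **Solution of the homological equation removing the terms linear in the transverse
variables.**  Under the first Melnikov condition `|k₁ω ± Ω_j| ≥ α > 0`, for coefficients
with `N = Σ_{j,k}(|a_{j,k}| + |b_{j,k}|)e^{|k|σ} < ∞`, the series defining `χ` converges
absolutely, `χ` solves `ω ∂χ/∂q₁ + Σ_j iΩ_j(ξ_j ∂χ/∂ξ_j − η_j ∂χ/∂η_j) = f`, and
`Σ_{j,k}(|a_{j,k}|/|k₁ω + Ω_j| + |b_{j,k}|/|k₁ω − Ω_j|)e^{|k|σ} ≤ N/α`. -/
theorem homological_equation_transverse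
    (n₁ n₂ : ℕ) (hn₁ : 0 < n₁) (hn₂ : 0 < n₂)
    (ω : ℝ) (Ω : Fin n₂ → ℝ) (σ α : ℝ) (hσ : 0 < σ) (hα : 0 < α)
    (hMelnikov : ∀ (k₁ : ℤ) (j : Fin n₂),
      α ≤ |(k₁ : ℝ) * ω + Ω j| ∧ α ≤ |(k₁ : ℝ) * ω - Ω j|)
    (a b : Fin n₂ → (Fin n₁ → ℤ) → ℂ)
    (hN : Summable (fun p : Fin n₂ × (Fin n₁ → ℤ) =>
      (‖a p.1 p.2‖ + ‖b p.1 p.2‖) * Real.exp (((∑ j, (p.2 j).natAbs : ℕ) : ℝ) * σ)))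
    (f χ : (Fin n₁ → ℝ) × (Fin n₂ → ℂ) × (Fin n₂ → ℂ) → ℂ)
    (hf : ∀ x, f x = ∑' p : Fin n₂ × (Fin n₁ → ℤ), transvTerm n₁ n₂ a b p x)
    (hχ : ∀ x, χ x = ∑' p : Fin n₂ × (Fin n₁ → ℤ), genTerm n₁ n₂ ⟨0, hn₁⟩ ω Ω a b p x) :
    (∀ x : (Fin n₁ → ℝ) × (Fin n₂ → ℂ) × (Fin n₂ → ℂ),
      Summable (fun p : Fin n₂ × (Fin n₁ → ℤ) => ‖genTerm n₁ n₂ ⟨0, hn₁⟩ ω Ω a b p x‖)) ∧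
    (∀ x : (Fin n₁ → ℝ) × (Fin n₂ → ℂ) × (Fin n₂ → ℂ),
      (ω : ℂ) * fderiv ℝ χ x (Pi.single ⟨0, hn₁⟩ 1, 0, 0) +
        ∑ j : Fin n₂, Complex.I * (Ω j : ℂ) *
          (x.2.1 j * fderiv ℝ χ x (0, Pi.single j 1, 0) -
           x.2.2 j * fderiv ℝ χ x (0, 0, Pi.single j 1)) = f x) ∧
    Summable (fun p : Fin n₂ × (Fin n₁ → ℤ) =>
      (‖a p.1 p.2‖ / |(p.2 ⟨0, hn₁⟩ : ℝ) * ω + Ω p.1| +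
       ‖b p.1 p.2‖ / |(p.2 ⟨0, hn₁⟩ : ℝ) * ω - Ω p.1|) *
        Real.exp (((∑ j, (p.2 j).natAbs : ℕ) : ℝ) * σ)) ∧
    (∑' p : Fin n₂ × (Fin n₁ → ℤ),
        (‖a p.1 p.2‖ / |(p.2 ⟨0, hn₁⟩ : ℝ) * ω + Ω p.1| +
         ‖b p.1 p.2‖ / |(p.2 ⟨0, hn₁⟩ : ℝ) * ω - Ω p.1|) *
          Real.exp (((∑ j, (p.2 j).natAbs : ℕ) : ℝ) * σ)) ≤
      (∑' p : Fin n₂ × (Fin n₁ → ℤ),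
        (‖a p.1 p.2‖ + ‖b p.1 p.2‖) *
          Real.exp (((∑ j, (p.2 j).natAbs : ℕ) : ℝ) * σ)) / α := by
  have hle : ∀ p : Fin n₂ × (Fin n₁ → ℤ),
      (‖a p.1 p.2‖ / |(p.2 ⟨0, hn₁⟩ : ℝ) * ω + Ω p.1| +
        ‖b p.1 p.2‖ / |(p.2 ⟨0, hn₁⟩ : ℝ) * ω - Ω p.1|) *
          Real.exp (((∑ j, (p.2 j).natAbs : ℕ) : ℝ) * σ) ≤
      (‖a p.1 p.2‖ + ‖b p.1 p.2‖) *
        Real.exp (((∑ j, (p.2 j).natAbs : ℕ) : ℝ) * σ) / α := fun p =>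
    div_add_div_mul_le hα (norm_nonneg _) (norm_nonneg _) (Real.exp_nonneg _)
      (hMelnikov _ _).1 (hMelnikov _ _).2
  have hS := Summable.of_nonneg_of_le (fun p => by positivity) hle (hN.div_const α)
  have hnorm : ∀ r : ℝ, ‖Complex.I * (r : ℂ)‖ = |r| := fun r => by simp
  let A : Fin n₂ → (Fin n₁ → ℤ) → ℂ := fun j k =>
    a j k / (Complex.I * ((k ⟨0, hn₁⟩ : ℂ) * (ω : ℂ) + (Ω j : ℂ)))
  let B : Fin n₂ → (Fin n₁ → ℤ) → ℂ := fun j k =>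
    b j k / (Complex.I * ((k ⟨0, hn₁⟩ : ℂ) * (ω : ℂ) - (Ω j : ℂ)))
  have hdA : ∀ (k : Fin n₁ → ℤ) (j : Fin n₂),
      ‖Complex.I * ((k ⟨0, hn₁⟩ : ℂ) * (ω : ℂ) + (Ω j : ℂ))‖ =
        |(k ⟨0, hn₁⟩ : ℝ) * ω + Ω j| := fun k j => by
    rw [← hnorm]; push_cast; rfl
  have hdB : ∀ (k : Fin n₁ → ℤ) (j : Fin n₂),
      ‖Complex.I * ((k ⟨0, hn₁⟩ : ℂ) * (ω : ℂ) - (Ω j : ℂ))‖ =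
        |(k ⟨0, hn₁⟩ : ℝ) * ω - Ω j| := fun k j => by
    rw [← hnorm]; push_cast; rfl
  have hAB : Summable (fun p : Fin n₂ × (Fin n₁ → ℤ) =>
      (‖A p.1 p.2‖ + ‖B p.1 p.2‖) *
        Real.exp (((∑ j, (p.2 j).natAbs : ℕ) : ℝ) * σ)) := by
    simpa only [A, B, norm_div, hdA, hdB] using hS
  have haA : (fun j k => Complex.I * ((k ⟨0, hn₁⟩ : ℂ) * ω + Ω j) * A j k) = a := by
    funext j k
    refine mul_div_cancel₀ _ (norm_pos_iff.1 ?_)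
    rw [hdA]
    exact hα.trans_le (hMelnikov _ _).1
  have hbB : (fun j k => Complex.I * ((k ⟨0, hn₁⟩ : ℂ) * ω - Ω j) * B j k) = b := by
    funext j k
    refine mul_div_cancel₀ _ (norm_pos_iff.1 ?_)
    rw [hdB]
    exact hα.trans_le (hMelnikov _ _).2
  have hgen : genTerm n₁ n₂ ⟨0, hn₁⟩ ω Ω a b = transvTerm n₁ n₂ A B := rfl
  rw [hgen] at hχ ⊢
  obtain rfl : χ = fun y => ∑' p, transvTerm n₁ n₂ A B p y := funext hχ
  refine ⟨summable_norm_transvTerm hσ hAB, fun x => ?_, hS, ?_⟩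
  · rw [transport_tsum_transvTerm hσ hAB, haA, hbB, hf]
  · rw [← tsum_div_const]
    exact hS.tsum_le_tsum hle (hN.div_const α)
end

section
/- Let γ ≠ 0 and I* > 0 be real numbers. For (q₂, q₃, q₄) with q₂, q₃, q₄ ∈ {0, π}, consider the 3×3 diagonal matrix γB with diagonal entries d₁ = −2εγ I* cos(q₂) + ε² cos²(q₂), d₂ = −ε² cos(q₃), d₃ = −2εγ I* cos(q₄) + ε² cos²(q₄). Then there exists ε* > 0 such that for all ε with 0 < ε < ε*: if γ > 0, the matrix γB is positive definite (all three diagonal entries strictly positive) exactly for the configuration (q₂, q₃, q₄) = (π, π, π) among the eight configurations with entries in {0, π}; and if γ < 0, it is positive definite exactly for the configuration (0, π, 0). -/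
open Real

/-- Below the threshold `2|γ|I`, the sign of a first-order entry is that of `-γ cos q`. -/
theorem firstOrder_entry_pos_iff {γ I ε q : ℝ} (hI : 0 < I) (hε : 0 < ε)
    (hlt : ε < 2 * |γ| * I) (hq : q = 0 ∨ q = π) :
    0 < -2 * ε * γ * I * cos q + ε ^ 2 * (cos q) ^ 2 ↔ γ * cos q < 0 := by
  have hsq : (cos q) ^ 2 = 1 := by rcases hq with rfl | rfl <;> simp
  have habs : |γ| = |γ * cos q| := by
    rcases hq with rfl | rfl <;> simp
  have hfac : -2 * ε * γ * I * cos q + ε ^ 2 * (cos q) ^ 2 =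
      ε * (ε - 2 * (γ * cos q) * I) := by rw [hsq]; ring
  rw [hfac, mul_pos_iff_of_pos_left hε]
  rw [habs] at hlt
  constructor
  · intro h
    by_contra! hc
    rw [abs_of_nonneg hc] at hlt
    linarith
  · intro h
    have := mul_pos_of_neg_of_neg h (neg_lt_zero.2 hI)
    linarith

/-- The second-order entry is positive exactly in the out-of-phase configuration. -/
theorem secondOrder_entry_pos_iff {ε q : ℝ} (hε : 0 < ε) (hq : q = 0 ∨ q = π) :
    0 < -ε ^ 2 * cos q ↔ q = π := by
  rcases hq with rfl | rfl
  · simp [pi_ne_zero.symm, sq_nonneg]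
  · simp [hε]

theorem mul_cos_neg_iff_of_pos {γ q : ℝ} (hγ : 0 < γ) (hq : q = 0 ∨ q = π) :
    γ * cos q < 0 ↔ q = π := by
  rcases hq with rfl | rfl
  · simp [pi_ne_zero.symm, hγ.le]
  · simp [hγ]

theorem mul_cos_neg_iff_of_neg {γ q : ℝ} (hγ : γ < 0) (hq : q = 0 ∨ q = π) :
    γ * cos q < 0 ↔ q = 0 := by
  rcases hq with rfl | rfl
  · simp [hγ]
  · simp [pi_ne_zero, hγ.le]

/-- **Linear stability of the in/out-of-phase configurations in the seagull example.**
For `γ ≠ 0`, `I* > 0` and the diagonal matrix `γB` with entries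
`d₁ = −2εγI* cos q₂ + ε² cos² q₂`, `d₂ = −ε² cos q₃`, `d₃ = −2εγI* cos q₄ + ε² cos² q₄`,
there is `ε* > 0` such that for all `0 < ε < ε*` and every configuration
`(q₂, q₃, q₄) ∈ {0, π}³`:  if `γ > 0` all three entries are strictly positive exactly for
`(π, π, π)`, and if `γ < 0` exactly for `(0, π, 0)`. -/
theorem seagull_linear_stability
    (γ Istar : ℝ) (hγ : γ ≠ 0) (hI : 0 < Istar) :
    ∃ εstar > 0, ∀ ε : ℝ, 0 < ε → ε < εstar →
      ∀ q₂ q₃ q₄ : ℝ,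
        (q₂ = 0 ∨ q₂ = π) → (q₃ = 0 ∨ q₃ = π) → (q₄ = 0 ∨ q₄ = π) →
        ((0 < γ →
          ((0 < -2 * ε * γ * Istar * cos q₂ + ε ^ 2 * (cos q₂) ^ 2 ∧
            0 < -ε ^ 2 * cos q₃ ∧
            0 < -2 * ε * γ * Istar * cos q₄ + ε ^ 2 * (cos q₄) ^ 2) ↔
           (q₂ = π ∧ q₃ = π ∧ q₄ = π))) ∧
         (γ < 0 →
          ((0 < -2 * ε * γ * Istar * cos q₂ + ε ^ 2 * (cos q₂) ^ 2 ∧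
            0 < -ε ^ 2 * cos q₃ ∧
            0 < -2 * ε * γ * Istar * cos q₄ + ε ^ 2 * (cos q₄) ^ 2) ↔
           (q₂ = 0 ∧ q₃ = π ∧ q₄ = 0)))) := by
  refine ⟨2 * |γ| * Istar, by positivity, fun ε hε hlt q₂ q₃ q₄ h₂ h₃ h₄ => ?_⟩
  rw [firstOrder_entry_pos_iff hI hε hlt h₂, firstOrder_entry_pos_iff hI hε hlt h₄,
    secondOrder_entry_pos_iff hε h₃]
  refine ⟨fun h => ?_, fun h => ?_⟩
  · rw [mul_cos_neg_iff_of_pos h h₂, mul_cos_neg_iff_of_pos h h₄]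
  · rw [mul_cos_neg_iff_of_neg h h₂, mul_cos_neg_iff_of_neg h h₄]
end
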